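/- arXiv:2512.12688 — 4 statements merged into one kernel-verified Lean document; each statement's English description precedes it below -/
import Mathlib

section
/- Let L ≥ 1 be a natural number, τ > 0, Δ > 0, let s ∈ ℝ^L have an (i*,Δ)-margin for some index i* ∈ {1,…,L}, and set α := π_τ(s). Let V be a real normed vector space and let v_1,…,v_L ∈ V. Then ‖Σ_{j=1}^L α_j v_j − v_{i*}‖ ≤ (1 − α_{i*}) · max_{j ∈ {1,…,L}} ‖v_j − v_{i*}‖ ≤ (L−1)·exp(−Δ/τ) · max_{j ∈ {1,…,L}} ‖v_j − v_{i*}‖. -/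
/-- Temperature-`τ` softmax of a score vector `s : Fin L → ℝ`. -/
noncomputable def softmaxT {L : ℕ} (τ : ℝ) (s : Fin L → ℝ) (i : Fin L) : ℝ :=
  Real.exp (s i / τ) / ∑ j, Real.exp (s j / τ)

theorem softmax_readout_copying_error
    {L : ℕ} (hL : 1 ≤ L) (τ Δ : ℝ) (hτ : 0 < τ) (hΔ : 0 < Δ)
    (s : Fin L → ℝ) (istar : Fin L)
    (hmargin : ∀ j : Fin L, j ≠ istar → s j + Δ ≤ s istar)
    {V : Type*} [NormedAddCommGroup V] [NormedSpace ℝ V]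
    (v : Fin L → V) :
    ‖(∑ j, softmaxT τ s j • v j) - v istar‖ ≤
        (1 - softmaxT τ s istar) *
          (Finset.univ.sup' (Finset.univ_nonempty_iff.mpr
            ⟨istar⟩) fun j => ‖v j - v istar‖) ∧
      (1 - softmaxT τ s istar) *
          (Finset.univ.sup' (Finset.univ_nonempty_iff.mpr
            ⟨istar⟩) fun j => ‖v j - v istar‖) ≤
        ((L : ℝ) - 1) * Real.exp (-Δ / τ) *
          (Finset.univ.sup' (Finset.univ_nonempty_iff.mpr
            ⟨istar⟩) fun j => ‖v j - v istar‖) := by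
  have hpos : 0 < ∑ j, Real.exp (s j / τ) :=
    Finset.sum_pos (fun j _ => Real.exp_pos _) ⟨istar, Finset.mem_univ _⟩
  have hnn : ∀ j, 0 ≤ softmaxT τ s j := fun j => div_nonneg (Real.exp_pos _).le hpos.le
  have hsum : ∑ j, softmaxT τ s j = 1 := by
    unfold softmaxT
    rw [← Finset.sum_div]
    exact div_self hpos.ne'
  have herase : ∑ j ∈ Finset.univ.erase istar, softmaxT τ s j = 1 - softmaxT τ s istar := by
    have h := Finset.add_sum_erase Finset.univ (softmaxT τ s) (Finset.mem_univ istar)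
    linarith
  have hM : ∀ j, ‖v j - v istar‖ ≤ Finset.univ.sup' (Finset.univ_nonempty_iff.mpr
      ⟨istar⟩) fun j => ‖v j - v istar‖ := fun j =>
    Finset.le_sup' (fun j => ‖v j - v istar‖) (Finset.mem_univ j)
  generalize (Finset.univ.sup' (Finset.univ_nonempty_iff.mpr
      ⟨istar⟩) fun j => ‖v j - v istar‖) = M at hM ⊢
  have hM0 : 0 ≤ M := (norm_nonneg _).trans (hM istar)
  constructor
  · have h1 : (∑ j, softmaxT τ s j • v j) - v istar
        = ∑ j ∈ Finset.univ.erase istar, softmaxT τ s j • (v j - v istar) := by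
      rw [Finset.sum_erase _ (by simp)]
      simp only [smul_sub, Finset.sum_sub_distrib]
      rw [← Finset.sum_smul, hsum, one_smul]
    rw [h1, ← herase, Finset.sum_mul]
    refine norm_sum_le_of_le _ fun j _ => ?_
    rw [norm_smul, Real.norm_of_nonneg (hnn j)]
    exact mul_le_mul_of_nonneg_left (hM j) (hnn j)
  · refine mul_le_mul_of_nonneg_right ?_ hM0
    rw [← herase]
    have hb : ∀ j ∈ Finset.univ.erase istar, softmaxT τ s j ≤ Real.exp (-Δ / τ) := by
      intro j hj
      have hj' := hmargin j (Finset.ne_of_mem_erase hj)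
      unfold softmaxT
      rw [div_le_iff₀ hpos]
      have h2 : Real.exp (s istar / τ) ≤ ∑ j, Real.exp (s j / τ) :=
        Finset.single_le_sum (f := fun j => Real.exp (s j / τ))
          (fun j _ => (Real.exp_pos _).le) (Finset.mem_univ istar)
      refine le_trans ?_ (mul_le_mul_of_nonneg_left h2 (Real.exp_pos _).le)
      rw [← Real.exp_add, Real.exp_le_exp, ← add_div]
      exact div_le_div_of_nonneg_right (by linarith) hτ.le
    have h3 := Finset.sum_le_card_nsmul _ _ _ hb
    rw [Finset.card_erase_of_mem (Finset.mem_univ _), Finset.card_univ, Fintype.card_fin,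
      nsmul_eq_mul, Nat.cast_sub hL, Nat.cast_one] at h3
    exact h3
end

section
/- Let L ≥ 1 be a natural number, τ > 0, Δ > 0, let s ∈ ℝ^L have an (i*,Δ)-margin for some index i* ∈ {1,…,L}, and set α := π_τ(s). Let D ≥ 1 and let v_1,…,v_L ∈ ℝ^D satisfy ‖v_j‖_∞ ≤ B for all j, where B > 0. Then ‖Σ_{j=1}^L α_j v_j − v_{i*}‖_∞ ≤ 2B·(1 − α_{i*}) ≤ 2B·(L−1)·exp(−Δ/τ). -/
/- `Fin D → ℝ` carries the sup norm `‖u‖ = max_i |u_i|`. -/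
theorem softmax_readout_error_bounded_values
    {L D : ℕ} (hL : 1 ≤ L) (hD : 1 ≤ D) (τ Δ B : ℝ)
    (hτ : 0 < τ) (hΔ : 0 < Δ) (hB : 0 < B)
    (s : Fin L → ℝ) (istar : Fin L)
    (hmargin : ∀ j : Fin L, j ≠ istar → s j + Δ ≤ s istar)
    (v : Fin L → (Fin D → ℝ)) (hv : ∀ j, ‖v j‖ ≤ B) :
    ‖(∑ j, softmaxT τ s j • v j) - v istar‖ ≤ 2 * B * (1 - softmaxT τ s istar) ∧
      2 * B * (1 - softmaxT τ s istar) ≤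
        2 * B * (((L : ℝ) - 1) * Real.exp (-Δ / τ)) := by
  have hZ : 0 < ∑ j, Real.exp (s j / τ) :=
    Finset.sum_pos (fun j _ => Real.exp_pos _) ⟨istar, Finset.mem_univ _⟩
  have hnn : ∀ j, 0 ≤ softmaxT τ s j := fun j =>
    div_nonneg (Real.exp_pos _).le hZ.le
  have hsum : ∑ j, softmaxT τ s j = 1 := by
    unfold softmaxT
    rw [← Finset.sum_div]
    exact div_self hZ.ne'
  have herase : ∑ j ∈ Finset.univ.erase istar, softmaxT τ s j = 1 - softmaxT τ s istar := by
    have h := Finset.sum_erase_add Finset.univ (softmaxT τ s) (Finset.mem_univ istar)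
    linarith
  constructor
  · have h1 : (∑ j, softmaxT τ s j • v j) - v istar
        = ∑ j ∈ Finset.univ.erase istar, softmaxT τ s j • (v j - v istar) := by
      have h2 : ∑ j ∈ Finset.univ.erase istar, softmaxT τ s j • (v j - v istar)
          = ∑ j, softmaxT τ s j • (v j - v istar) := by
        apply Finset.sum_erase
        simp
      rw [h2]
      simp only [smul_sub, Finset.sum_sub_distrib]
      rw [← Finset.sum_smul, hsum, one_smul]
    rw [h1, ← herase, Finset.mul_sum]
    refine (norm_sum_le _ _).trans (Finset.sum_le_sum fun j _ => ?_)
    rw [norm_smul, Real.norm_of_nonneg (hnn j), mul_comm]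
    refine mul_le_mul_of_nonneg_right ?_ (hnn j)
    have := norm_sub_le (v j) (v istar)
    linarith [hv j, hv istar]
  · refine mul_le_mul_of_nonneg_left ?_ (by positivity)
    rw [← herase]
    have hb : ∀ j ∈ Finset.univ.erase istar, softmaxT τ s j ≤ Real.exp (-Δ / τ) := by
      intro j hj
      have hm := hmargin j (Finset.ne_of_mem_erase hj)
      unfold softmaxT
      rw [div_le_iff₀ hZ]
      have h3 : Real.exp (s istar / τ) ≤ ∑ j, Real.exp (s j / τ) :=
        Finset.single_le_sum (f := fun j => Real.exp (s j / τ))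
          (fun j _ => (Real.exp_pos _).le) (Finset.mem_univ istar)
      refine le_trans ?_ (mul_le_mul_of_nonneg_left h3 (Real.exp_pos _).le)
      rw [← Real.exp_add, ← add_div]
      apply Real.exp_le_exp.mpr
      apply div_le_div_of_nonneg_right _ hτ.le
      linarith
    refine (Finset.sum_le_card_nsmul _ _ _ hb).trans (le_of_eq ?_)
    rw [Finset.card_erase_of_mem (Finset.mem_univ _), nsmul_eq_mul, Finset.card_univ,
      Fintype.card_fin, Nat.cast_sub hL, Nat.cast_one]
end

section
/- Let L ≥ 2 be a natural number, Δ > 0, ρ ∈ (0,1), and let s ∈ ℝ^L have an (i*,Δ)-margin for some index i* ∈ {1,…,L}. If the temperature satisfies 0 < τ ≤ Δ / log((L−1)/ρ), then 1 − π_τ(s)_{i*} ≤ ρ. Consequently, if in addition v_1,…,v_L ∈ ℝ^D satisfy ‖v_j‖_∞ ≤ B for all j with B > 0, then ‖Σ_{j=1}^L π_τ(s)_j v_j − v_{i*}‖_∞ ≤ 2Bρ. -/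
/- `Fin D → ℝ` carries the sup norm `‖u‖ = max_i |u_i|`. -/
theorem temperature_choice_for_desired_impurity
    {L D : ℕ} (hL : 2 ≤ L) (Δ ρ τ B : ℝ)
    (hΔ : 0 < Δ) (hρ : ρ ∈ Set.Ioo (0 : ℝ) 1)
    (hτ0 : 0 < τ) (hτ : τ ≤ Δ / Real.log (((L : ℝ) - 1) / ρ))
    (s : Fin L → ℝ) (istar : Fin L)
    (hmargin : ∀ j : Fin L, j ≠ istar → s j + Δ ≤ s istar)
    (hB : 0 < B) :
    1 - softmaxT τ s istar ≤ ρ ∧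
      ∀ v : Fin L → (Fin D → ℝ), (∀ j, ‖v j‖ ≤ B) →
        ‖(∑ j, softmaxT τ s j • v j) - v istar‖ ≤ 2 * B * ρ := by
  obtain ⟨hρ0, hρ1⟩ := hρ
  have hL' : (2 : ℝ) ≤ (L : ℝ) := by exact_mod_cast hL
  have hq : 1 < ((L : ℝ) - 1) / ρ := by
    rw [lt_div_iff₀ hρ0]; linarith
  have hlog : 0 < Real.log (((L : ℝ) - 1) / ρ) := Real.log_pos hq
  have h1 : Real.log (((L : ℝ) - 1) / ρ) ≤ Δ / τ := by
    rw [le_div_iff₀ hlog] at hτ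
    rw [le_div_iff₀ hτ0]; linarith
  have h2 : ((L : ℝ) - 1) ≤ ρ * Real.exp (Δ / τ) := by
    have := (Real.log_le_iff_le_exp (by linarith)).1 h1
    rw [div_le_iff₀ hρ0] at this
    linarith
  have hne : (Finset.univ : Finset (Fin L)).Nonempty := ⟨istar, Finset.mem_univ _⟩
  have hZ : 0 < ∑ j, Real.exp (s j / τ) := Finset.sum_pos (fun j _ => Real.exp_pos _) hne
  have hnn : ∀ j, 0 ≤ softmaxT τ s j := fun j => div_nonneg (Real.exp_pos _).le hZ.le
  have hsum : ∑ j, softmaxT τ s j = 1 := by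
    unfold softmaxT
    rw [← Finset.sum_div, div_self hZ.ne']
  have hsplit : ∑ j, Real.exp (s j / τ)
      = Real.exp (s istar / τ) + ∑ j ∈ Finset.univ.erase istar, Real.exp (s j / τ) :=
    (Finset.add_sum_erase _ _ (Finset.mem_univ istar)).symm
  have hrest : ∑ j ∈ Finset.univ.erase istar, Real.exp (s j / τ)
      ≤ ρ * Real.exp (s istar / τ) := by
    have hb : ∀ j ∈ Finset.univ.erase istar,
        Real.exp (s j / τ) ≤ Real.exp (s istar / τ - Δ / τ) := by
      intro j hj
      apply Real.exp_le_exp.2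
      rw [← sub_div]
      have := hmargin j (Finset.ne_of_mem_erase hj)
      exact div_le_div_of_nonneg_right (by linarith) hτ0.le
    have h3 := Finset.sum_le_card_nsmul _ _ _ hb
    rw [Finset.card_erase_of_mem (Finset.mem_univ _), Finset.card_univ, Fintype.card_fin,
      nsmul_eq_mul, Nat.cast_sub (by omega), Nat.cast_one, Real.exp_sub] at h3
    refine h3.trans ?_
    rw [← mul_div_assoc, div_le_iff₀ (Real.exp_pos _)]
    have := mul_le_mul_of_nonneg_right h2 (Real.exp_pos (s istar / τ)).le
    linarith
  have hmain : 1 - softmaxT τ s istar ≤ ρ := by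
    unfold softmaxT
    rw [sub_le_comm, le_div_iff₀ hZ]
    have h4 : 0 ≤ ∑ j ∈ Finset.univ.erase istar, Real.exp (s j / τ) :=
      Finset.sum_nonneg fun j _ => (Real.exp_pos _).le
    rw [hsplit]
    nlinarith [mul_nonneg hρ0.le h4]
  refine ⟨hmain, fun v hv => ?_⟩
  have hrw : (∑ j, softmaxT τ s j • v j) - v istar
      = ∑ j ∈ Finset.univ.erase istar, softmaxT τ s j • (v j - v istar) := by
    have h5 : ∑ j, softmaxT τ s j • (v j - v istar)
        = (∑ j, softmaxT τ s j • v j) - v istar := by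
      simp only [smul_sub, Finset.sum_sub_distrib]
      rw [← Finset.sum_smul, hsum, one_smul]
    rw [← h5, ← Finset.add_sum_erase _ _ (Finset.mem_univ istar)]
    simp
  have hπ : ∑ j ∈ Finset.univ.erase istar, softmaxT τ s j = 1 - softmaxT τ s istar := by
    rw [← hsum, ← Finset.add_sum_erase _ _ (Finset.mem_univ istar)]
    ring
  rw [hrw]
  calc _ ≤ ∑ j ∈ Finset.univ.erase istar, softmaxT τ s j * (2 * B) := by
        apply norm_sum_le_of_le
        intro j _
        rw [norm_smul, Real.norm_of_nonneg (hnn j)]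
        apply mul_le_mul_of_nonneg_left _ (hnn j)
        have := norm_sub_le (v j) (v istar)
        linarith [hv j, hv istar]
    _ = (1 - softmaxT τ s istar) * (2 * B) := by rw [← Finset.sum_mul, hπ]
    _ ≤ ρ * (2 * B) := mul_le_mul_of_nonneg_right hmain (by linarith)
    _ = 2 * B * ρ := by ring
end

section
/- Fix B > 0 and D ≥ 1, and let 𝓑_B := [−B, B]^D ⊂ ℝ^D. Let f : 𝓑_B → ℝ^D be continuous. Then for every δ > 0 there exist a natural number h ≥ 1, matrices W_1 ∈ ℝ^{h×D}, W_2 ∈ ℝ^{D×h}, and vectors b_1 ∈ ℝ^h, b_2 ∈ ℝ^D such that the two-layer ReLU network φ(z) := W_2 σ(W_1 z + b_1) + b_2 satisfies sup_{z ∈ 𝓑_B} ‖φ(z) − f(z)‖_∞ ≤ δ. -/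
/-- ReLU activation applied coordinatewise. -/
def relu {k : ℕ} (x : Fin k → ℝ) : Fin k → ℝ := fun i => max (x i) 0

open MeasureTheory in
/-- The averaged Taylor formula for `exp` with ReLU kernels. -/
theorem exp_relu_formula (M t : ℝ) (h1 : -M ≤ t) (h2 : t ≤ M) :
    ∫ s in (-M)..M, Real.exp s * max (t - s) 0
      = Real.exp t - Real.exp (-M) * (t + M + 1) := by
  have hc : Continuous fun s : ℝ => Real.exp s * max (t - s) 0 := by fun_prop
  rw [← intervalIntegral.integral_add_adjacent_intervals (hc.intervalIntegrable (-M) t)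
    (hc.intervalIntegrable t M)]
  have e2 : ∫ s in t..M, Real.exp s * max (t - s) 0 = 0 := by
    rw [intervalIntegral.integral_congr (g := fun _ => (0 : ℝ))]
    · simp
    · intro s hs
      rw [Set.uIcc_of_le h2] at hs
      have : max (t - s) 0 = 0 := max_eq_right (by linarith [hs.1])
      simp [this]
  have e1 : ∫ s in (-M)..t, Real.exp s * max (t - s) 0
      = ∫ s in (-M)..t, Real.exp s * (t - s) := by
    apply intervalIntegral.integral_congr
    intro s hs
    rw [Set.uIcc_of_le h1] at hs
    have : max (t - s) 0 = t - s := max_eq_left (by linarith [hs.2])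
    simp [this]
  have e3 : ∫ s in (-M)..t, Real.exp s * (t - s)
      = Real.exp t * (t - t + 1) - Real.exp (-M) * (t - (-M) + 1) := by
    apply intervalIntegral.integral_eq_sub_of_hasDerivAt
      (f := fun s => Real.exp s * (t - s + 1))
    · intro s _
      have h := (Real.hasDerivAt_exp s).mul (((hasDerivAt_id s).const_sub t).add_const 1)
      refine HasDerivAt.congr_deriv h ?_
      simp
      ring
    · exact Continuous.intervalIntegrable (by fun_prop) _ _
  rw [e1, e2, e3]
  ring

/-- A single ReLU neuron as a continuous function on `K`. -/
noncomputable def neuron {D : ℕ} (K : Set (Fin D → ℝ)) (p : (Fin D → ℝ) × ℝ) : C(K, ℝ) :=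
  ⟨fun z => max (p.1 ⬝ᵥ z.1 + p.2) 0, by fun_prop⟩

/-- A ridge exponential as a continuous function on `K`. -/
noncomputable def ridgeExp {D : ℕ} (K : Set (Fin D → ℝ)) (w : Fin D → ℝ) : C(K, ℝ) :=
  ⟨fun z => Real.exp (w ⬝ᵥ z.1), by fun_prop⟩

open MeasureTheory in
theorem ridgeExp_mem {D : ℕ} (K : Set (Fin D → ℝ)) [CompactSpace K] (w : Fin D → ℝ) :
    ridgeExp K w ∈ (Submodule.span ℝ (Set.range (neuron K))).topologicalClosure := by
  set N := (Submodule.span ℝ (Set.range (neuron K))).topologicalClosure with hN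
  have hmem : ∀ p, neuron K p ∈ N := fun p =>
    Submodule.le_topologicalClosure _ (Submodule.subset_span ⟨p, rfl⟩)
  let lin : C(K, ℝ) := ⟨fun z => w ⬝ᵥ z.1, by fun_prop⟩
  obtain ⟨M, hM0, hM⟩ : ∃ M : ℝ, 0 < M ∧ ∀ z : K, |w ⬝ᵥ z.1| ≤ M :=
    ⟨‖lin‖ + 1, by positivity, fun z => (lin.norm_coe_le_norm z).trans (by linarith)⟩
  let F : ℝ → C(K, ℝ) := fun s => Real.exp s • neuron K (w, -s)
  have hFc : Continuous F := by
    apply Continuous.smul Real.continuous_exp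
    apply ContinuousMap.continuous_of_continuous_uncurry
    simp only [Function.uncurry_def, neuron, ContinuousMap.coe_mk]
    fun_prop
  have hI : ∫ s in (-M)..M, F s ∈ N := by
    have hav : (⨍ s in Set.Ioc (-M) M, F s) ∈ (N : Set C(K, ℝ)) := by
      apply Convex.set_average_mem N.convex (Submodule.isClosed_topologicalClosure _)
      · simp [hM0]
      · simp
      · exact Filter.Eventually.of_forall fun s => N.smul_mem _ (hmem _)
      · exact (hFc.intervalIntegrable (-M) M).1
    rw [setAverage_eq] at hav
    rw [intervalIntegral.integral_of_le (by linarith)]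
    have hne : (volume.real (Set.Ioc (-M) M)) ≠ 0 := by
      simp [hM0.le]
      linarith
    exact (N.smul_mem_iff (inv_ne_zero hne)).1 hav
  have key : ridgeExp K w = (∫ s in (-M)..M, F s)
      + Real.exp (-M) • (neuron K (w, M) + neuron K (0, 1)) := by
    ext z
    have hz := abs_le.1 (hM z)
    have h1 : (∫ s in (-M)..M, F s) z = ∫ s in (-M)..M, F s z :=
      ((ContinuousMap.evalCLM ℝ z).intervalIntegral_comp_comm
        (hFc.intervalIntegrable (-M) M)).symm
    have h2 := exp_relu_formula M (w ⬝ᵥ z.1) hz.1 hz.2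
    have h3 : max (w ⬝ᵥ z.1 + M) 0 = w ⬝ᵥ z.1 + M := max_eq_left (by linarith)
    rw [ContinuousMap.add_apply, h1]
    simp only [F, neuron, ridgeExp, ContinuousMap.smul_apply, ContinuousMap.coe_mk,
      ContinuousMap.add_apply, smul_eq_mul, ← sub_eq_add_neg, zero_dotProduct, h3]
    rw [h2]
    simp
  rw [key]
  exact N.add_mem hI (N.smul_mem _ (N.add_mem (hmem _) (hmem _)))

theorem neuron_dense {D : ℕ} (K : Set (Fin D → ℝ)) [CompactSpace K] :
    (Submodule.span ℝ (Set.range (neuron K))).topologicalClosure = ⊤ := by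
  set N := (Submodule.span ℝ (Set.range (neuron K))).topologicalClosure with hN
  let A : Subalgebra ℝ C(K, ℝ) := Algebra.adjoin ℝ (Set.range (ridgeExp K))
  have hA : Subalgebra.toSubmodule A ≤ N := by
    rw [Algebra.adjoin_eq_span, Submodule.span_le]
    have hcl : ∀ g ∈ Submonoid.closure (Set.range (ridgeExp K)), ∃ w, ridgeExp K w = g := by
      intro g hg
      induction hg using Submonoid.closure_induction with
      | mem x hx => exact hx
      | one => exact ⟨0, by ext z; simp [ridgeExp]⟩
      | mul x y _ _ hx hy =>
        obtain ⟨a, rfl⟩ := hx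
        obtain ⟨b, rfl⟩ := hy
        exact ⟨a + b, by ext z; simp [ridgeExp, add_dotProduct, Real.exp_add]⟩
    intro g hg
    obtain ⟨w, rfl⟩ := hcl g hg
    exact ridgeExp_mem K w
  have hsep : A.SeparatesPoints := by
    intro x y hxy
    obtain ⟨i, hi⟩ : ∃ i, x.1 i ≠ y.1 i := by
      by_contra! h
      exact hxy (Subtype.ext (funext h))
    refine ⟨_, ⟨ridgeExp K (Pi.single i 1), Algebra.subset_adjoin ⟨_, rfl⟩, rfl⟩, ?_⟩
    simpa [ridgeExp] using hi
  have htop := ContinuousMap.subalgebra_topologicalClosure_eq_top_of_separatesPoints A hsep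
  rw [eq_top_iff]
  intro g _
  have hg : g ∈ A.topologicalClosure := htop ▸ Algebra.mem_top
  exact closure_minimal (s := (A : Set C(K, ℝ))) (t := (N : Set C(K, ℝ))) hA
    (Submodule.isClosed_topologicalClosure _) hg

/- `Fin D → ℝ` carries the sup norm; `{z | ∀ i, |z i| ≤ B}` is the box `[-B,B]^D`. -/
theorem two_layer_relu_approximates_continuous_updates_on_box
    (B : ℝ) (hB : 0 < B) (D : ℕ) (hD : 1 ≤ D)
    (f : (Fin D → ℝ) → (Fin D → ℝ))
    (hf : ContinuousOn f {z : Fin D → ℝ | ∀ i, |z i| ≤ B})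
    (δ : ℝ) (hδ : 0 < δ) :
    ∃ (h : ℕ) (_ : 1 ≤ h) (W1 : Matrix (Fin h) (Fin D) ℝ)
      (W2 : Matrix (Fin D) (Fin h) ℝ) (b1 : Fin h → ℝ) (b2 : Fin D → ℝ),
      ∀ z : Fin D → ℝ, (∀ i, |z i| ≤ B) →
        ‖(W2.mulVec (relu (W1.mulVec z + b1)) + b2) - f z‖ ≤ δ := by
  classical
  set K : Set (Fin D → ℝ) := {z : Fin D → ℝ | ∀ i, |z i| ≤ B} with hK
  have hKc : IsCompact K := by
    have : K = Set.univ.pi fun _ => Set.Icc (-B) B := by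
      ext z
      simp only [hK, abs_le, Set.mem_pi, Set.mem_univ, true_imp_iff, Set.mem_Icc, Set.mem_setOf_eq]
    rw [this]
    exact isCompact_univ_pi fun _ => isCompact_Icc
  have : CompactSpace K := isCompact_iff_compactSpace.1 hKc
  have hfr : Continuous (K.domRestrict f) := continuousOn_iff_continuous_domRestrict.1 hf
  let g : Fin D → C(K, ℝ) := fun j => ⟨fun z => f z.1 j, (continuous_apply j).comp hfr⟩
  have happ : ∀ j, ∃ c : ((Fin D → ℝ) × ℝ) →₀ ℝ,
      ‖(c.sum fun p a => a • neuron K p) - g j‖ ≤ δ := by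
    intro j
    have hg : g j ∈ (Submodule.span ℝ (Set.range (neuron K))).topologicalClosure := by
      rw [neuron_dense]
      trivial
    obtain ⟨u, hu, hd⟩ := Metric.mem_closure_iff.1 hg δ hδ
    obtain ⟨c, rfl⟩ := Finsupp.mem_span_range_iff_exists_finsupp.1 hu
    refine ⟨c, ?_⟩
    rw [dist_comm, dist_eq_norm] at hd
    exact hd.le
  choose c hc using happ
  let T : Finset ((Fin D → ℝ) × ℝ) := insert 0 (Finset.univ.biUnion fun j => (c j).support)
  let e : Fin T.card ≃ T := T.equivFin.symm
  refine ⟨T.card, Finset.card_pos.2 ⟨0, Finset.mem_insert_self _ _⟩,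
    Matrix.of fun i => (e i).1.1, Matrix.of fun j i => c j (e i).1, fun i => (e i).1.2, 0, ?_⟩
  intro z hz
  rw [pi_norm_le_iff_of_nonneg hδ.le]
  intro j
  have hj := ((c j).sum (fun p a => a • neuron K p) - g j).norm_coe_le_norm ⟨z, hz⟩
  refine le_trans (le_of_eq ?_) (hj.trans (hc j))
  congr 1
  simp only [Pi.sub_apply, Pi.add_apply, Pi.zero_apply, add_zero, ContinuousMap.sub_apply]
  congr 1
  have hsub : (c j).support ⊆ T := fun p hp =>
    Finset.mem_insert_of_mem (Finset.mem_biUnion.2 ⟨j, Finset.mem_univ _, hp⟩)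
  rw [Finsupp.sum_of_support_subset _ hsub _ (by simp)]
  simp only [ContinuousMap.coe_sum, Finset.sum_apply, ContinuousMap.smul_apply, neuron,
    ContinuousMap.coe_mk, smul_eq_mul]
  rw [← Finset.sum_coe_sort T, ← e.sum_comp]
  rfl
end
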